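/- arXiv:2410.22915 — 7 statements merged into one kernel-verified Lean document; each statement's English description precedes it below -/
import Mathlib

section
/- For every n ≥ 1 and every real number t, the determinant of the Lorentz product of the Fibonacci–Hessenberg matrices C_{n,t} and D_{n,t} equals det(C_{n,t} ·_L D_{n,t}) = −F_{n+1}F_{2n−1}·t² − (F_{n+1}F_{2n} + F_{n}F_{2n−1})·t − F_{n}F_{2n}. -/
/-- The n×n Lorentz signature matrix J = diag(-1,1,...,1). -/
def lorentzJ (n : ℕ) : Matrix (Fin n) (Fin n) ℝ :=
  Matrix.diagonal fun j => if (j : ℕ) = 0 then -1 else 1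

/-- The Lorentz matrix product: (A ·_L B) i k = -a_{i1} b_{1k} + ∑_{j≥2} a_{ij} b_{jk},
equivalently A · J · B. -/
def lorentzMul {m n p : ℕ} (A : Matrix (Fin m) (Fin n) ℝ) (B : Matrix (Fin n) (Fin p) ℝ) :
    Matrix (Fin m) (Fin p) ℝ :=
  A * lorentzJ n * B

/-- Fibonacci-Hessenberg matrix C_{n,t} -/
def Cmat (n : ℕ) (t : ℝ) : Matrix (Fin n) (Fin n) ℝ :=
  Matrix.of fun i j =>
    if (i : ℕ) + 1 < (j : ℕ) then 0
    else if (j : ℕ) = (i : ℕ) + 1 then 1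
    else if (i : ℕ) = (j : ℕ) then (if (i : ℕ) + 1 = n then t + 1 else 2)
    else 1

/-- Fibonacci-Hessenberg matrix D_{n,t} -/
def Dmat (n : ℕ) (t : ℝ) : Matrix (Fin n) (Fin n) ℝ :=
  Matrix.of fun i j =>
    if (i : ℕ) + 1 < (j : ℕ) then 0
    else if (j : ℕ) = (i : ℕ) + 1 then -1
    else if (i : ℕ) = (j : ℕ) then (if (i : ℕ) + 1 = n then t + 1 else 2)
    else 1

/-- The lower Hessenberg matrix of size `n + 2` with superdiagonal entries `c`, ones below the
diagonal, and diagonal `a, 2, …, 2, t + 1`. -/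
def hessenbergMat (c a t : ℝ) (n : ℕ) : Matrix (Fin (n + 2)) (Fin (n + 2)) ℝ :=
  Matrix.of fun i j =>
    if (i : ℕ) + 1 < (j : ℕ) then 0
    else if (j : ℕ) = (i : ℕ) + 1 then c
    else if (i : ℕ) = (j : ℕ) then
      (if (i : ℕ) = 0 then a else if (i : ℕ) = n + 1 then t + 1 else 2)
    else 1

theorem det_hessenbergMat_zero (c a t : ℝ) :
    (hessenbergMat c a t 0).det = a * (t + 1) - c := by
  simp [Matrix.det_fin_two, hessenbergMat]

theorem hessenbergMat_submatrix_succ_succ (c a t : ℝ) (n : ℕ) :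
    (hessenbergMat c a t (n + 1)).submatrix Fin.succ Fin.succ = hessenbergMat c 2 t n := by
  ext i j
  simp only [hessenbergMat, Matrix.submatrix_apply, Matrix.of_apply, Fin.val_succ]
  grind

theorem hessenbergMat_submatrix_succ_succAbove_one (c a t : ℝ) (n : ℕ) :
    (hessenbergMat c a t (n + 1)).submatrix Fin.succ (Fin.succAbove 1) =
      hessenbergMat c 1 t n := by
  ext i j
  refine Fin.cases ?_ (fun k => ?_) j
  · simp +contextual [hessenbergMat, Fin.succAbove]
  · have h : (Fin.succAbove (1 : Fin (n + 3)) k.succ : ℕ) = k + 2 := by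
      simp [Fin.succAbove, Fin.lt_def]
    simp only [hessenbergMat, Matrix.submatrix_apply, Matrix.of_apply, Fin.val_succ, h]
    grind

theorem det_hessenbergMat_succ (c a t : ℝ) (n : ℕ) :
    (hessenbergMat c a t (n + 1)).det =
      a * (hessenbergMat c 2 t n).det - c * (hessenbergMat c 1 t n).det := by
  have h₀ : hessenbergMat c a t (n + 1) 0 0 = a := by simp [hessenbergMat]
  have h₁ : hessenbergMat c a t (n + 1) 0 1 = c := by simp [hessenbergMat]
  have h₂ (j : Fin (n + 1)) : hessenbergMat c a t (n + 1) 0 j.succ.succ = 0 := by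
    simp [hessenbergMat]
  rw [Matrix.det_succ_row_zero, Fin.sum_univ_succ, Fin.sum_univ_succ]
  simp only [h₂, Fin.succ_zero_eq_one, h₀, h₁, Fin.succAbove_zero,
    hessenbergMat_submatrix_succ_succ, hessenbergMat_submatrix_succ_succAbove_one]
  simp
  ring

theorem Cmat_eq_hessenbergMat (n : ℕ) (t : ℝ) : Cmat (n + 2) t = hessenbergMat 1 2 t n := by
  ext i j
  simp only [Cmat, hessenbergMat, Matrix.of_apply]
  grind

theorem Dmat_eq_hessenbergMat (n : ℕ) (t : ℝ) : Dmat (n + 2) t = hessenbergMat (-1) 2 t n := by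
  ext i j
  simp only [Dmat, hessenbergMat, Matrix.of_apply]
  grind

theorem det_hessenbergMat_one (t : ℝ) (n : ℕ) :
    (hessenbergMat 1 2 t n).det = Nat.fib (n + 3) * t + Nat.fib (n + 2) ∧
      (hessenbergMat 1 1 t n).det = Nat.fib (n + 1) * t + Nat.fib n := by
  induction n with
  | zero => norm_num [det_hessenbergMat_zero, Nat.fib_add_two]; ring
  | succ n ih =>
    simp only [det_hessenbergMat_succ, ih, Nat.fib_add_two, Nat.cast_add]
    constructor <;> ring

theorem det_hessenbergMat_neg_one (t : ℝ) (n : ℕ) :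
    (hessenbergMat (-1) 2 t n).det = Nat.fib (2 * n + 3) * t + Nat.fib (2 * n + 4) ∧
      (hessenbergMat (-1) 1 t n).det = Nat.fib (2 * n + 2) * t + Nat.fib (2 * n + 3) := by
  induction n with
  | zero =>
    norm_num [det_hessenbergMat_zero, Nat.fib_add_two]
    constructor <;> ring
  | succ n ih =>
    simp only [det_hessenbergMat_succ, ih, mul_add, mul_one, Nat.fib_add_two, Nat.cast_add]
    constructor <;> ring

theorem det_Cmat (n : ℕ) (t : ℝ) :
    (Cmat (n + 1) t).det = Nat.fib (n + 2) * t + Nat.fib (n + 1) := by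
  cases n with
  | zero => simp [Cmat]
  | succ n => rw [Cmat_eq_hessenbergMat, (det_hessenbergMat_one t n).1]

theorem det_Dmat (n : ℕ) (t : ℝ) :
    (Dmat (n + 1) t).det = Nat.fib (2 * n + 1) * t + Nat.fib (2 * n + 2) := by
  cases n with
  | zero => simp [Dmat]
  | succ n => rw [Dmat_eq_hessenbergMat, (det_hessenbergMat_neg_one t n).1]; rfl

theorem det_lorentzJ (n : ℕ) : (lorentzJ (n + 1)).det = -1 := by
  simp [lorentzJ, Matrix.det_diagonal]

theorem det_lorentz_CD (n : ℕ) (hn : 1 ≤ n) (t : ℝ) :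
    (lorentzMul (Cmat n t) (Dmat n t)).det =
      -((Nat.fib (n + 1) : ℝ) * (Nat.fib (2 * n - 1) : ℝ)) * t ^ 2
        - ((Nat.fib (n + 1) : ℝ) * (Nat.fib (2 * n) : ℝ)
            + (Nat.fib n : ℝ) * (Nat.fib (2 * n - 1) : ℝ)) * t
        - (Nat.fib n : ℝ) * (Nat.fib (2 * n) : ℝ) := by
  obtain ⟨m, rfl⟩ := Nat.exists_eq_add_of_le' hn
  rw [lorentzMul, Matrix.det_mul, Matrix.det_mul, det_Cmat, det_Dmat, det_lorentzJ,
    show 2 * (m + 1) - 1 = 2 * m + 1 by omega, show 2 * (m + 1) = 2 * m + 2 by ring]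
  ring
end

section
/- For every n ≥ 2 and every real number t, the determinant of the Fibonacci–Hessenberg matrix E_{n,t} equals det E_{n,t} = F_{2n−2}·t + F_{2n−1}. -/
/-- Fibonacci-Hessenberg matrix E_{n,t} -/
def Emat (n : ℕ) (t : ℝ) : Matrix (Fin n) (Fin n) ℝ :=
  Matrix.of fun i j =>
    if (i : ℕ) + 1 < (j : ℕ) then 0
    else if (j : ℕ) = (i : ℕ) + 1 then -1
    else if (i : ℕ) = (j : ℕ) then (if (i : ℕ) + 1 = n then t + 1 else if (i : ℕ) = 0 then 1 else 2)
    else 1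

/-- The Fibonacci–Hessenberg matrix of size `n` with its top-left entry replaced by `a`. -/
def EmatCorner (n : ℕ) (a t : ℝ) : Matrix (Fin n) (Fin n) ℝ :=
  Matrix.of fun i j =>
    if (i : ℕ) + 1 < (j : ℕ) then 0
    else if (j : ℕ) = (i : ℕ) + 1 then -1
    else if (i : ℕ) = (j : ℕ) then (if (i : ℕ) + 1 = n then t + 1 else if (i : ℕ) = 0 then a else 2)
    else 1

theorem EmatCorner_submatrix_zero (n : ℕ) (a t : ℝ) :
    (EmatCorner (n + 3) a t).submatrix Fin.succ (Fin.succAbove 0) = EmatCorner (n + 2) 2 t := by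
  ext i j
  simp [EmatCorner]

theorem EmatCorner_submatrix_one (n : ℕ) (a t : ℝ) :
    (EmatCorner (n + 3) a t).submatrix Fin.succ (Fin.succAbove 1) = EmatCorner (n + 2) 1 t := by
  ext i j
  refine Fin.cases ?_ (fun j => ?_) j
  · simp only [EmatCorner, Matrix.submatrix_apply, Matrix.of_apply, Fin.one_succAbove_zero,
      Fin.val_succ, Fin.val_zero]
    split_ifs <;> first | rfl | contradiction | omega
  · simp only [EmatCorner, Matrix.submatrix_apply, Matrix.of_apply, Fin.one_succAbove_succ,
      Fin.val_succ]
    split_ifs <;> first | rfl | contradiction | omega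

/-- Expansion along the first row. -/
theorem det_EmatCorner_succ (n : ℕ) (a t : ℝ) :
    (EmatCorner (n + 3) a t).det =
      a * (EmatCorner (n + 2) 2 t).det + (EmatCorner (n + 2) 1 t).det := by
  rw [Matrix.det_succ_row_zero, Fin.sum_univ_succ, Fin.sum_univ_succ, Finset.sum_eq_zero]
  · rw [Fin.succ_zero_eq_one, EmatCorner_submatrix_zero, EmatCorner_submatrix_one]
    simp [EmatCorner]
  · intro j _
    simp [EmatCorner]

theorem det_EmatCorner (n : ℕ) (t : ℝ) :
    (EmatCorner (n + 2) 1 t).det = Nat.fib (2 * n + 2) * t + Nat.fib (2 * n + 3) ∧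
      (EmatCorner (n + 2) 2 t).det = Nat.fib (2 * n + 3) * t + Nat.fib (2 * n + 4) := by
  induction n with
  | zero =>
    constructor <;> simp [Matrix.det_fin_two, EmatCorner, Nat.fib_add_two] <;> ring
  | succ n ih =>
    have h4 : Nat.fib (2 * n + 4) = Nat.fib (2 * n + 2) + Nat.fib (2 * n + 3) := Nat.fib_add_two
    have h5 : Nat.fib (2 * n + 5) = Nat.fib (2 * n + 3) + Nat.fib (2 * n + 4) := Nat.fib_add_two
    have h6 : Nat.fib (2 * n + 6) = Nat.fib (2 * n + 4) + Nat.fib (2 * n + 5) := Nat.fib_add_two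
    rw [show n + 1 + 2 = n + 3 from rfl, det_EmatCorner_succ, det_EmatCorner_succ, ih.1, ih.2,
      show 2 * (n + 1) + 2 = 2 * n + 4 by ring, show 2 * (n + 1) + 3 = 2 * n + 5 by ring,
      show 2 * (n + 1) + 4 = 2 * n + 6 by ring, h6, h5, h4]
    push_cast
    constructor <;> ring

theorem det_Emat (n : ℕ) (hn : 2 ≤ n) (t : ℝ) :
    (Emat n t).det = (Nat.fib (2 * n - 2) : ℝ) * t + (Nat.fib (2 * n - 1) : ℝ) := by
  obtain ⟨m, rfl⟩ := Nat.exists_eq_add_of_le' hn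
  rw [show 2 * (m + 2) - 2 = 2 * m + 2 by omega, show 2 * (m + 2) - 1 = 2 * m + 3 by omega]
  exact (det_EmatCorner m t).1
end

section
/- For every n ≥ 1 and every real number t, the determinant of the Fibonacci–Hessenberg matrix F_{n,t} equals det F_{n,t} = F_{n} + t·F_{n+1}. -/
/-- Fibonacci-Hessenberg matrix F_{n,t} -/
def Fmat (n : ℕ) (t : ℝ) : Matrix (Fin n) (Fin n) ℝ :=
  Matrix.of fun i j =>
    if (i : ℕ) + 1 < (j : ℕ) then 0
    else if (j : ℕ) = (i : ℕ) + 1 then -1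
    else if (i : ℕ) = (j : ℕ) then (if (i : ℕ) + 1 = n then t + 1 else 2)
    else (-1 : ℝ) ^ ((i : ℕ) + (j : ℕ))

theorem Fmat_submatrix_succ (n : ℕ) (t : ℝ) :
    (Fmat (n + 1) t).submatrix Fin.succ Fin.succ = Fmat n t := by
  ext i j
  have h : (-1 : ℝ) ^ ((i : ℕ) + 1 + ((j : ℕ) + 1)) = (-1) ^ ((i : ℕ) + (j : ℕ)) := by ring
  simp [Fmat, h]

/-- Deleting the first row and the second column of `Fmat (n + 3) t` gives `Fmat (n + 2) t` with
its first column `c` replaced by `e₀ - c`. -/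
theorem Fmat_submatrix_succ_succAbove_one (n : ℕ) (t : ℝ) :
    (Fmat (n + 3) t).submatrix Fin.succ (Fin.succAbove 1) =
      (Fmat (n + 2) t).updateCol 0
        ((-1 : ℝ) • (fun i => Fmat (n + 2) t i 0) + Pi.single 0 1) := by
  ext i j
  refine Fin.cases ?_ (fun j => ?_) j
  · refine Fin.cases ?_ (fun i => ?_) i
    · simp [Fmat]
      norm_num
    · simp [Fmat, pow_succ]
  · have h : Fin.succAbove (1 : Fin (n + 3)) j.succ = j.succ.succ :=
      Fin.succAbove_of_le_castSucc _ _ (by simp [Fin.le_def])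
    rw [Matrix.submatrix_apply, h, Matrix.updateCol_ne (Fin.succ_ne_zero j),
      ← Fmat_submatrix_succ (n + 2) t, Matrix.submatrix_apply]

theorem det_Fmat_updateCol_single (n : ℕ) (t : ℝ) :
    ((Fmat (n + 1) t).updateCol 0 (Pi.single 0 1)).det = (Fmat n t).det := by
  rw [Matrix.det_succ_column_zero, Fin.sum_univ_succ, ← Fmat_submatrix_succ n t]
  have h : ((Fmat (n + 1) t).updateCol 0 (Pi.single 0 1)).submatrix Fin.succ Fin.succ =
      (Fmat (n + 1) t).submatrix Fin.succ Fin.succ := by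
    ext i j
    simp
  simp [h]

theorem det_Fmat_add_three (n : ℕ) (t : ℝ) :
    (Fmat (n + 3) t).det = (Fmat (n + 2) t).det + (Fmat (n + 1) t).det := by
  have hminor : ((Fmat (n + 3) t).submatrix Fin.succ (Fin.succAbove 1)).det =
      -(Fmat (n + 2) t).det + (Fmat (n + 1) t).det := by
    rw [Fmat_submatrix_succ_succAbove_one, Matrix.det_updateCol_add, Matrix.det_updateCol_smul,
      det_Fmat_updateCol_single, Matrix.updateCol_eq_self]
    ring
  have h0 : Fmat (n + 3) t 0 0 = 2 := by simp [Fmat]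
  have h1 : Fmat (n + 3) t 0 1 = -1 := by simp [Fmat]
  have h2 (j : Fin (n + 1)) : Fmat (n + 3) t 0 j.succ.succ = 0 := by simp [Fmat]
  rw [Matrix.det_succ_row_zero, Fin.sum_univ_succ, Fin.sum_univ_succ]
  simp only [h2, Fin.succ_zero_eq_one, h0, h1, hminor, Fin.succAbove_zero, Fmat_submatrix_succ]
  simp
  ring

theorem det_Fmat (n : ℕ) (hn : 1 ≤ n) (t : ℝ) :
    (Fmat n t).det = (Nat.fib n : ℝ) + t * (Nat.fib (n + 1) : ℝ) := by
  obtain ⟨n, rfl⟩ := Nat.exists_eq_add_of_le' hn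
  clear hn
  induction n using Nat.twoStepInduction with
  | zero => simp [Fmat, add_comm]
  | one =>
    simp [Fmat, Matrix.det_fin_two, Nat.fib_add_two]
    ring
  | more n ih₀ ih₁ =>
    rw [det_Fmat_add_three, ih₀, ih₁]
    change _ = (Nat.fib (n + 1 + 2) : ℝ) + t * (Nat.fib (n + 1 + 1 + 2) : ℝ)
    rw [Nat.fib_add_two (n := n + 1 + 1), show n + 1 + 1 + 1 = n + 1 + 2 from rfl,
      Nat.fib_add_two (n := n + 1)]
    push_cast
    ring
end

section
/- For every n ≥ 2 and every real number t, the determinant of the Fibonacci–Hessenberg matrix G_{n,t} equals det G_{n,t} = F_{n−2} + t·F_{n−1}. -/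
/-- Fibonacci-Hessenberg matrix G_{n,t} -/
def Gmat (n : ℕ) (t : ℝ) : Matrix (Fin n) (Fin n) ℝ :=
  Matrix.of fun i j =>
    if (i : ℕ) + 1 < (j : ℕ) then 0
    else if (j : ℕ) = (i : ℕ) + 1 then -1
    else if (i : ℕ) = (j : ℕ) then (if (i : ℕ) + 1 = n then t + 1 else if (i : ℕ) = 0 then 1 else 2)
    else (-1 : ℝ) ^ ((i : ℕ) + (j : ℕ))

/-- A determinant whose last row and column vanish outside the trailing `2 × 2` block. -/
theorem Matrix.det_of_trailing_block {R : Type*} [CommRing R] {k : ℕ}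
    (A : Matrix (Fin (k + 2)) (Fin (k + 2)) R)
    (hrow : ∀ j : Fin k, A (Fin.last _) j.castSucc.castSucc = 0)
    (hcol : ∀ i : Fin k, A i.castSucc.castSucc (Fin.last _) = 0) :
    A.det = A (Fin.last _) (Fin.last _) * (A.submatrix Fin.castSucc Fin.castSucc).det
      - A (Fin.last _) (Fin.last k).castSucc * A (Fin.last k).castSucc (Fin.last _)
        * (A.submatrix (fun i : Fin k => i.castSucc.castSucc)
            (fun i : Fin k => i.castSucc.castSucc)).det := by
  have hsucc : ∀ j : Fin k, (Fin.last k).castSucc.succAbove j.castSucc = j.castSucc.castSucc :=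
    fun j => Fin.succAbove_of_castSucc_lt _ _ (Fin.castSucc_lt_castSucc_iff.2 j.castSucc_lt_last)
  have hlast : (Fin.last k).castSucc.succAbove (Fin.last k) = Fin.last (k + 1) :=
    Fin.succAbove_of_le_castSucc _ _ le_rfl
  have hminor : (A.submatrix Fin.castSucc (Fin.last k).castSucc.succAbove).det
      = A (Fin.last k).castSucc (Fin.last _)
        * (A.submatrix (fun i : Fin k => i.castSucc.castSucc)
            (fun i : Fin k => i.castSucc.castSucc)).det := by
    rw [Matrix.det_succ_column _ (Fin.last k), Fin.sum_univ_castSucc, Finset.sum_eq_zero]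
    · have hsub : (A.submatrix Fin.castSucc (Fin.last k).castSucc.succAbove).submatrix
          (Fin.last k).succAbove (Fin.last k).succAbove
          = A.submatrix (fun i : Fin k => i.castSucc.castSucc)
              (fun i : Fin k => i.castSucc.castSucc) := by
        ext i j
        simp [hsucc]
      rw [hsub]
      simp [hlast, ← two_mul]
    · intro i _
      simp [hlast, hcol]
  rw [Matrix.det_succ_row A (Fin.last _), Fin.sum_univ_castSucc, Fin.sum_univ_castSucc,
    Finset.sum_eq_zero]
  · have hodd : (-1 : R) ^ (k + 1 + k) = -1 := Odd.neg_one_pow ⟨k, by ring⟩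
    have heven : (-1 : R) ^ (k + 1 + (k + 1)) = 1 := Even.neg_one_pow ⟨k + 1, rfl⟩
    simp only [Fin.succAbove_last, hminor, Fin.val_last, Fin.val_castSucc, hodd, heven]
    ring
  · intro j _
    simp [hrow]

theorem Gmat_det_succ (k : ℕ) (t : ℝ) :
    (Gmat (k + 3) t).det = t * (Gmat (k + 2) 1).det
      + (Gmat (k + 1) (if k = 0 then 0 else 1)).det := by
  have hne : Fin.last (k + 2) ≠ (Fin.last (k + 1)).castSucc := (Fin.castSucc_lt_last _).ne'
  rw [← Matrix.det_updateRow_add_self (Gmat (k + 3) t) hne, Matrix.det_of_trailing_block]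
  · have hbig : ((Gmat (k + 3) t).updateRow (Fin.last (k + 2)) (Gmat (k + 3) t (Fin.last (k + 2))
        + Gmat (k + 3) t (Fin.last (k + 1)).castSucc)).submatrix Fin.castSucc Fin.castSucc
        = Gmat (k + 2) 1 := by
      ext i j
      have hi := i.isLt
      simp only [Matrix.submatrix_apply, Matrix.updateRow_ne (Fin.castSucc_lt_last _).ne, Gmat,
        Matrix.of_apply, Fin.val_castSucc]
      split_ifs <;> first | rfl | omega | norm_num
    have hsmall : ((Gmat (k + 3) t).updateRow (Fin.last (k + 2)) (Gmat (k + 3) t (Fin.last (k + 2))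
        + Gmat (k + 3) t (Fin.last (k + 1)).castSucc)).submatrix
          (fun i : Fin (k + 1) => i.castSucc.castSucc) (fun i : Fin (k + 1) => i.castSucc.castSucc)
        = Gmat (k + 1) (if k = 0 then 0 else 1) := by
      ext i j
      have hi := i.isLt
      simp only [Matrix.submatrix_apply, Matrix.updateRow_ne (Fin.castSucc_lt_last _).ne, Gmat,
        Matrix.of_apply, Fin.val_castSucc]
      split_ifs <;> first | rfl | omega | norm_num
    rw [hbig, hsmall, Matrix.updateRow_self, Matrix.updateRow_ne hne.symm]
    have hodd : (-1 : ℝ) ^ (k + 2 + (k + 1)) = -1 := Odd.neg_one_pow ⟨k + 1, by ring⟩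
    simp [Gmat, hodd]
    ring
  · intro j
    have hj := j.isLt
    have h1 : ¬ k + 2 + 1 < (j : ℕ) := by omega
    have h2 : ¬ (j : ℕ) = k + 2 + 1 := by omega
    have h3 : ¬ k + 2 = (j : ℕ) := by omega
    have h4 : ¬ k + 1 + 1 < (j : ℕ) := by omega
    have h5 : ¬ (j : ℕ) = k + 1 + 1 := by omega
    have h6 : ¬ k + 1 = (j : ℕ) := by omega
    simp only [Matrix.updateRow_self, Pi.add_apply, Gmat, Matrix.of_apply, Fin.val_castSucc,
      Fin.val_last, if_neg h1, if_neg h2, if_neg h3, if_neg h4, if_neg h5, if_neg h6]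
    ring
  · intro i
    have hi := i.isLt
    rw [Matrix.updateRow_ne (Fin.castSucc_lt_last _).ne]
    simp only [Gmat, Matrix.of_apply, Fin.val_castSucc, Fin.val_last]
    exact if_pos (by omega)

theorem Gmat_one_det (t : ℝ) : (Gmat 1 t).det = t + 1 := by
  simp [Gmat]

theorem Gmat_two_det (t : ℝ) : (Gmat 2 t).det = t := by
  simp [Gmat, Matrix.det_fin_two]

theorem Gmat_det_add_two (k : ℕ) (t : ℝ) :
    (Gmat (k + 2) t).det = (Nat.fib k : ℝ) + t * (Nat.fib (k + 1) : ℝ) := by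
  induction k using Nat.strong_induction_on generalizing t with
  | _ k ih =>
    match k with
    | 0 => simp [Gmat_two_det]
    | 1 =>
      rw [Gmat_det_succ 0, Gmat_two_det, if_pos rfl, Gmat_one_det]
      simp [add_comm]
    | k + 2 =>
      rw [Gmat_det_succ (k + 1), ih (k + 1) (by omega), if_neg k.succ_ne_zero,
        ih k (by omega)]
      simp only [Nat.fib_add_two, Nat.cast_add]
      ring

theorem det_Gmat (n : ℕ) (hn : 2 ≤ n) (t : ℝ) :
    (Gmat n t).det = (Nat.fib (n - 2) : ℝ) + t * (Nat.fib (n - 1) : ℝ) := by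
  obtain ⟨k, rfl⟩ := Nat.exists_eq_add_of_le' hn
  exact Gmat_det_add_two k t
end

section
/- For every n ≥ 2 and every real number t, the determinant of the Fibonacci–Hessenberg matrix H_{n,t} equals det H_{n,t} = F_{2n−1} + t·F_{2n−2}. -/
/-- Fibonacci-Hessenberg matrix H_{n,t} -/
def Hmat (n : ℕ) (t : ℝ) : Matrix (Fin n) (Fin n) ℝ :=
  Matrix.of fun i j =>
    if (i : ℕ) + 1 < (j : ℕ) then 0
    else if (j : ℕ) = (i : ℕ) + 1 then 1
    else if (i : ℕ) = (j : ℕ) then (if (i : ℕ) + 1 = n then t + 1 else if (i : ℕ) = 0 then 1 else 2)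
    else (-1 : ℝ) ^ ((i : ℕ) + (j : ℕ))

theorem Hmat_submatrix_castSucc (m : ℕ) (t : ℝ) :
    (Hmat (m + 3) t).submatrix Fin.castSucc Fin.castSucc = Hmat (m + 2) 1 := by
  ext i j
  have hi := i.isLt
  simp only [Hmat, Matrix.submatrix_apply, Matrix.of_apply, Fin.val_castSucc]
  split_ifs <;> first | rfl | omega | norm_num

theorem Hmat_submatrix_succAbove (m : ℕ) (t : ℝ) :
    (Hmat (m + 3) t).submatrix (Fin.last (m + 1)).castSucc.succAbove Fin.castSucc =
      (Hmat (m + 2) 0).updateRow (Fin.last (m + 1))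
        ((-1 : ℝ) • Hmat (m + 2) 0 (Fin.last (m + 1))) := by
  ext i j
  have hj := j.isLt
  induction i using Fin.lastCases with
  | last =>
    have h : (Fin.last (m + 1)).castSucc.succAbove (Fin.last (m + 1)) = Fin.last (m + 2) := by
      rw [Fin.succAbove_castSucc_self, Fin.succ_last]
    rw [Matrix.updateRow_self, Matrix.submatrix_apply, h]
    simp only [Hmat, Matrix.of_apply, Fin.val_castSucc, Fin.val_last, Pi.smul_apply, smul_eq_mul]
    by_cases hjm : (j : ℕ) = m + 1
    · simp only [hjm]
      have : (-1 : ℝ) ^ (m + 2 + (m + 1)) = -1 := Odd.neg_one_pow ⟨m + 1, by ring⟩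
      simp [this]
    · rw [if_neg (by omega), if_neg (by omega), if_neg (by omega), if_neg (by omega),
        if_neg (by omega), if_neg (by omega)]
      ring
  | cast i =>
    have hi := i.isLt
    have h : (Fin.last (m + 1)).castSucc.succAbove i.castSucc = i.castSucc.castSucc :=
      Fin.succAbove_of_castSucc_lt _ _ (by simpa [Fin.lt_def] using Nat.le_of_lt_succ hi)
    rw [Matrix.updateRow_ne (Fin.castSucc_lt_last i).ne, Matrix.submatrix_apply, h]
    simp only [Hmat, Matrix.of_apply, Fin.val_castSucc]
    split_ifs <;> first | rfl | omega

theorem det_Hmat_succ (m : ℕ) (t : ℝ) :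
    (Hmat (m + 3) t).det = (t + 1) * (Hmat (m + 2) 1).det + (Hmat (m + 2) 0).det := by
  have h0 (i : Fin (m + 1)) :
      Hmat (m + 3) t i.castSucc.castSucc (Fin.last (m + 2)) = 0 := by
    have := i.isLt
    simp only [Hmat, Matrix.of_apply, Fin.val_castSucc, Fin.val_last]
    rw [if_pos (by omega)]
  have h1 : Hmat (m + 3) t (Fin.last (m + 1)).castSucc (Fin.last (m + 2)) = 1 := by
    simp [Hmat]
  have h2 : Hmat (m + 3) t (Fin.last (m + 2)) (Fin.last (m + 2)) = t + 1 := by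
    simp [Hmat]
  have hs : (-1 : ℝ) ^ (m + 1 + (m + 2)) = -1 := Odd.neg_one_pow ⟨m + 1, by ring⟩
  have he : (-1 : ℝ) ^ (m + 2 + (m + 2)) = 1 := Even.neg_one_pow ⟨m + 2, rfl⟩
  rw [Matrix.det_succ_column _ (Fin.last (m + 2)), Fin.sum_univ_castSucc, Fin.sum_univ_castSucc]
  simp only [h0, h1, h2, Fin.succAbove_last, Hmat_submatrix_castSucc, Hmat_submatrix_succAbove,
    Matrix.det_updateRow_smul, Fin.val_castSucc, Fin.val_last, hs, he]
  rw [Matrix.updateRow_eq_self]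
  simp
  ring

theorem det_Hmat (n : ℕ) (hn : 2 ≤ n) (t : ℝ) :
    (Hmat n t).det = (Nat.fib (2 * n - 1) : ℝ) + t * (Nat.fib (2 * n - 2) : ℝ) := by
  obtain ⟨m, rfl⟩ := Nat.exists_eq_add_of_le' hn
  clear hn
  rw [show 2 * (m + 2) - 1 = 2 * m + 3 by omega, show 2 * (m + 2) - 2 = 2 * m + 2 by omega]
  induction m generalizing t with
  | zero =>
    simp [Matrix.det_fin_two, Hmat, Nat.fib_add_two]
    ring
  | succ m ih =>
    rw [det_Hmat_succ, ih, ih, show 2 * (m + 1) + 3 = 2 * m + 5 by ring,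
      show 2 * (m + 1) + 2 = 2 * m + 4 by ring, Nat.fib_add_two (n := 2 * m + 3),
      Nat.fib_add_two (n := 2 * m + 2)]
    push_cast
    ring
end

section
/- For every n ≥ 1 and every real number t, the determinant of the Fibonacci–Hessenberg matrix K_{n,t} equals det K_{n,t} = F_{2n} + t·F_{2n−1}. -/
/-- Fibonacci-Hessenberg matrix K_{n,t} -/
def Kmat (n : ℕ) (t : ℝ) : Matrix (Fin n) (Fin n) ℝ :=
  Matrix.of fun i j =>
    if (i : ℕ) + 1 < (j : ℕ) then 0
    else if (j : ℕ) = (i : ℕ) + 1 then 1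
    else if (i : ℕ) = (j : ℕ) then (if (i : ℕ) + 1 = n then t + 1 else 2)
    else (-1 : ℝ) ^ ((i : ℕ) + (j : ℕ))

open Matrix in
/-- Laplace expansion along a first row of the form `(a, 1, 0, …, 0)`. -/
theorem det_of_row_zero_eq {R : Type*} [CommRing R] {n : ℕ}
    (A : Matrix (Fin (n + 2)) (Fin (n + 2)) R) (h1 : A 0 1 = 1)
    (h0 : ∀ j : Fin n, A 0 j.succ.succ = 0) :
    A.det = A 0 0 * (A.submatrix Fin.succ Fin.succ).det
      - (A.submatrix Fin.succ (Fin.succAbove 1)).det := by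
  rw [det_succ_row_zero, Fin.sum_univ_succ, Fin.sum_univ_succ]
  simp [h1, h0, sub_eq_add_neg]

/-- `Kmat (n + 1) t` with its first column replaced by the alternating signs. -/
def Kalt (n : ℕ) (t : ℝ) : Matrix (Fin (n + 1)) (Fin (n + 1)) ℝ :=
  (Kmat (n + 1) t).updateCol 0 fun i => (-1) ^ (i : ℕ)

theorem Kmat_submatrix_succ_succ (n : ℕ) (t : ℝ) :
    (Kmat (n + 2) t).submatrix Fin.succ Fin.succ = Kmat (n + 1) t := by
  ext i j
  have h : (-1 : ℝ) ^ ((i : ℕ) + 1 + (j + 1)) = (-1) ^ ((i : ℕ) + j) := by ring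
  simp [Kmat, h]

theorem Kalt_submatrix_succ_succ (n : ℕ) (t : ℝ) :
    (Kalt (n + 1) t).submatrix Fin.succ Fin.succ = Kmat (n + 1) t := by
  rw [← Kmat_submatrix_succ_succ]
  ext i j
  simp [Kalt]

theorem Kmat_submatrix_succ_succAbove_one (n : ℕ) (t : ℝ) :
    (Kmat (n + 2) t).submatrix Fin.succ (Fin.succAbove 1) =
      (Kmat (n + 1) t).updateCol 0 ((-1 : ℝ) • fun i : Fin (n + 1) => (-1 : ℝ) ^ (i : ℕ)) := by
  ext i j
  cases j using Fin.cases with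
  | zero => simp [Kmat, pow_succ]
  | succ j =>
    have hj : Fin.succAbove (1 : Fin (n + 2)) j.succ = j.succ.succ := by
      rw [← Fin.succ_zero_eq_one, Fin.succ_succAbove_succ, Fin.succAbove_zero]
    rw [Matrix.submatrix_apply, hj, Matrix.updateCol_ne (Fin.succ_ne_zero j),
      ← Kmat_submatrix_succ_succ n t, Matrix.submatrix_apply]

theorem Kalt_submatrix_succ_succAbove_one (n : ℕ) (t : ℝ) :
    (Kalt (n + 1) t).submatrix Fin.succ (Fin.succAbove 1) =
      (Kmat (n + 1) t).updateCol 0 ((-1 : ℝ) • fun i : Fin (n + 1) => (-1 : ℝ) ^ (i : ℕ)) := by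
  rw [← Kmat_submatrix_succ_succAbove_one]
  ext i j
  cases j using Fin.cases with
  | zero => simp [Kalt, Kmat, pow_succ]
  | succ j =>
    have hj : Fin.succAbove (1 : Fin (n + 2)) j.succ = j.succ.succ := by
      rw [← Fin.succ_zero_eq_one, Fin.succ_succAbove_succ, Fin.succAbove_zero]
    simp only [Matrix.submatrix_apply, hj, Kalt, Matrix.updateCol_ne (Fin.succ_ne_zero _)]

theorem det_Kmat_succ (n : ℕ) (t : ℝ) :
    (Kmat (n + 2) t).det = 2 * (Kmat (n + 1) t).det + (Kalt n t).det := by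
  rw [det_of_row_zero_eq _ (by simp [Kmat]) (by simp [Kmat]), Kmat_submatrix_succ_succ,
    Kmat_submatrix_succ_succAbove_one, Matrix.det_updateCol_smul]
  simp [Kmat, Kalt]

theorem det_Kalt_succ (n : ℕ) (t : ℝ) :
    (Kalt (n + 1) t).det = (Kmat (n + 1) t).det + (Kalt n t).det := by
  rw [det_of_row_zero_eq _ (by simp [Kmat, Kalt]) (by simp [Kmat, Kalt]),
    Kalt_submatrix_succ_succ, Kalt_submatrix_succ_succAbove_one, Matrix.det_updateCol_smul]
  simp [Kalt]

theorem det_Kmat_and_det_Kalt (n : ℕ) (t : ℝ) :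
    (Kmat (n + 1) t).det = (Nat.fib (2 * n + 2) : ℝ) + t * (Nat.fib (2 * n + 1) : ℝ) ∧
      (Kalt n t).det = (Nat.fib (2 * n + 1) : ℝ) + t * (Nat.fib (2 * n) : ℝ) := by
  induction n with
  | zero => simp [Kalt, Kmat, add_comm]
  | succ n ih =>
    have h2 : Nat.fib (2 * n + 2) = Nat.fib (2 * n) + Nat.fib (2 * n + 1) := Nat.fib_add_two
    have h3 : Nat.fib (2 * n + 3) = Nat.fib (2 * n + 1) + Nat.fib (2 * n + 2) := Nat.fib_add_two
    have h4 : Nat.fib (2 * n + 4) = Nat.fib (2 * n + 2) + Nat.fib (2 * n + 3) := Nat.fib_add_two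
    rw [det_Kmat_succ, det_Kalt_succ, ih.1, ih.2, show 2 * (n + 1) = 2 * n + 2 by ring, h4, h3, h2]
    push_cast
    constructor <;> ring

theorem det_Kmat (n : ℕ) (hn : 1 ≤ n) (t : ℝ) :
    (Kmat n t).det = (Nat.fib (2 * n) : ℝ) + t * (Nat.fib (2 * n - 1) : ℝ) := by
  obtain ⟨m, rfl⟩ := Nat.exists_eq_add_of_le' hn
  exact (det_Kmat_and_det_Kalt m t).1
end

section
/- For every n ≥ 1, the n×n real matrix B_n whose main-diagonal entries are 2 except the (n,n) entry which is 1, whose superdiagonal entries are 1, whose entries strictly below the diagonal are all 1, and whose entries above the superdiagonal are 0, has determinant det B_n = F_n. -/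
/-- Lower Hessenberg matrix with diagonal entries 2 except the last which is 1,
superdiagonal entries 1, entries below the diagonal 1 and zeros above the superdiagonal. -/
def Bmat (n : ℕ) : Matrix (Fin n) (Fin n) ℝ :=
  Matrix.of fun i j =>
    if (i : ℕ) + 1 < (j : ℕ) then 0
    else if (j : ℕ) = (i : ℕ) + 1 then 1
    else if (i : ℕ) = (j : ℕ) then (if (i : ℕ) + 1 = n then 1 else 2)
    else 1

open Matrix in
/-- Laplace expansion along a first row supported in the first two columns. -/
theorem Matrix.det_eq_of_row_zero_eq_zero {R : Type*} [CommRing R] {n : ℕ}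
    (A : Matrix (Fin (n + 2)) (Fin (n + 2)) R) (h : ∀ j : Fin n, A 0 j.succ.succ = 0) :
    A.det = A 0 0 * (A.submatrix Fin.succ Fin.succ).det
      - A 0 1 * (A.submatrix Fin.succ (Fin.succAbove 1)).det := by
  rw [det_succ_row_zero, Fin.sum_univ_succ, Fin.sum_univ_succ]
  simp [h, sub_eq_add_neg]

theorem Bmat_submatrix_succ_succ (n : ℕ) :
    (Bmat (n + 1)).submatrix Fin.succ Fin.succ = Bmat n := by
  ext i j
  simp [Bmat]

theorem Bmat_submatrix_succ_succAbove_one (n : ℕ) :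
    (Bmat (n + 2)).submatrix Fin.succ (Fin.succAbove 1)
      = (Bmat (n + 1)).updateCol 0 (fun _ => 1) := by
  ext i j
  cases j using Fin.cases with
  | zero => simp [Bmat]
  | succ j =>
    have h : (1 : Fin (n + 2)).succAbove j.succ = j.succ.succ := by
      rw [← Fin.succ_zero_eq_one, Fin.succ_succAbove_succ, Fin.zero_succAbove]
    simp [Bmat, h]

theorem det_Bmat_succ_succ (n : ℕ) :
    (Bmat (n + 2)).det
      = 2 * (Bmat (n + 1)).det - ((Bmat (n + 1)).updateCol 0 (fun _ => 1)).det := by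
  rw [Matrix.det_eq_of_row_zero_eq_zero _ (fun j => by simp [Bmat]),
    Bmat_submatrix_succ_succ, Bmat_submatrix_succ_succAbove_one]
  simp [Bmat]

theorem det_updateCol_Bmat_succ_succ (n : ℕ) :
    ((Bmat (n + 2)).updateCol 0 (fun _ => 1)).det
      = (Bmat (n + 1)).det - ((Bmat (n + 1)).updateCol 0 (fun _ => 1)).det := by
  have hsucc : ((Bmat (n + 2)).updateCol 0 (fun _ => 1)).submatrix Fin.succ Fin.succ
      = Bmat (n + 1) := by
    rw [← Bmat_submatrix_succ_succ (n + 1)]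
    ext i j
    simp
  have hone : ((Bmat (n + 2)).updateCol 0 (fun _ => 1)).submatrix Fin.succ (Fin.succAbove 1)
      = (Bmat (n + 1)).updateCol 0 (fun _ => 1) := by
    rw [← Bmat_submatrix_succ_succAbove_one]
    ext i j
    cases j using Fin.cases <;> simp [Bmat]
  rw [Matrix.det_eq_of_row_zero_eq_zero _ (fun j => by simp [Bmat]), hsucc, hone]
  simp [Bmat]

theorem det_Bmat_and_det_updateCol (n : ℕ) :
    (Bmat (n + 1)).det = Nat.fib (n + 1) ∧
      ((Bmat (n + 1)).updateCol 0 (fun _ => 1)).det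
        = 2 * (Nat.fib (n + 1) : ℝ) - Nat.fib (n + 2) := by
  induction n with
  | zero =>
    constructor <;> rw [Matrix.det_fin_one] <;> norm_num [Bmat]
  | succ n ih =>
    rw [det_Bmat_succ_succ, det_updateCol_Bmat_succ_succ, ih.1, ih.2,
      Nat.fib_add_two (n := n + 1)]
    push_cast
    constructor <;> ring

theorem det_Bmat (n : ℕ) (hn : 1 ≤ n) :
    (Bmat n).det = (Nat.fib n : ℝ) := by
  obtain ⟨m, rfl⟩ := Nat.exists_eq_add_of_le' hn
  exact (det_Bmat_and_det_updateCol m).1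
end
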